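/- arXiv:2310.12563 — 3 statements merged into one kernel-verified Lean document; each statement's English description precedes it below -/
import Mathlib

section
/- (Second-moment × erf Gaussian integral.) For all σ > 0, N_a > 0, N_b > 0 and a, b ∈ ℝ, ∫_{−∞}^{∞} (N_a(θ − a)²/(2σ²)) · (√N_a/√(2πσ²)) · exp(−N_a(θ − a)²/(2σ²)) · (1/2)[1 + erf(√N_b(θ − b)/√(2σ²))] dθ = (1/4)[1 + erf((a − b)/sqrt(2σ²(1/N_a + 1/N_b)))] + ((b − a)σ² / (2 N_a √(2π) (σ²/N_a + σ²/N_b)^{3/2})) · exp(−(a − b)²/(2σ²(1/N_a + 1/N_b))). -/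
open MeasureTheory

/-- The error function `erf x = (2/√π) ∫₀ˣ e^{−u²} du`. -/
noncomputable def erf (x : ℝ) : ℝ := (2 / Real.sqrt Real.pi) * ∫ u in (0:ℝ)..x, Real.exp (-u ^ 2)

/-- The complementary error function `erfc x = 1 − erf x`. -/
noncomputable def erfc (x : ℝ) : ℝ := 1 - erf x

lemma erf_hasDerivAt (x : ℝ) : HasDerivAt erf (2 / Real.sqrt Real.pi * Real.exp (-x ^ 2)) x := by
  have hc : Continuous fun u : ℝ => Real.exp (-u ^ 2) := by fun_prop
  exact (intervalIntegral.integral_hasDerivAt_right (hc.intervalIntegrable _ _)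
    (hc.stronglyMeasurableAtFilter _ _) hc.continuousAt).const_mul _

lemma erf_cont : Continuous erf :=
  continuous_iff_continuousAt.2 fun x => (erf_hasDerivAt x).continuousAt

lemma erf_neg' (x : ℝ) : erf (-x) = - erf x := by
  unfold erf
  have h := intervalIntegral.integral_comp_neg (a := 0) (b := x) (fun u : ℝ => Real.exp (-u ^ 2))
  simp only [neg_sq, neg_zero] at h
  rw [h, intervalIntegral.integral_symm (-x) 0]
  ring

lemma gauss_int : Integrable fun x : ℝ => Real.exp (-x ^ 2) := by
  simpa using integrable_exp_neg_mul_sq (b := 1) one_pos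

lemma erf_bdd (x : ℝ) : |erf x| ≤ 2 := by
  have hp : 0 < Real.sqrt Real.pi := Real.sqrt_pos.2 Real.pi_pos
  have h1 : |∫ u in (0:ℝ)..x, Real.exp (-u ^ 2)| ≤ Real.sqrt Real.pi := by
    rw [← Real.norm_eq_abs]
    refine (intervalIntegral.norm_integral_le_integral_norm_uIoc).trans ?_
    refine (setIntegral_le_integral gauss_int.norm
      (Filter.Eventually.of_forall fun u => norm_nonneg _)).trans ?_
    have := integral_gaussian 1
    simp at this
    simp [this]
  unfold erf
  rw [abs_mul, abs_of_pos (by positivity)]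
  calc _ ≤ 2 / Real.sqrt Real.pi * Real.sqrt Real.pi := by gcongr
    _ = 2 := by field_simp

lemma sq_int {s : ℝ} (hs : 0 < s) : Integrable fun x : ℝ => x ^ 2 * Real.exp (-s * x ^ 2) := by
  have := integrable_rpow_mul_exp_neg_mul_sq hs (s := 2) (by norm_num)
  simpa using this

lemma sq_moment {s : ℝ} (hs : 0 < s) :
    ∫ x : ℝ, x ^ 2 * Real.exp (-s * x ^ 2) = Real.sqrt (Real.pi / s) / (2 * s) := by
  have hd : ∀ x : ℝ, HasDerivAt (fun x : ℝ => x * Real.exp (-s * x ^ 2))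
      (Real.exp (-s * x ^ 2) - 2 * s * (x ^ 2 * Real.exp (-s * x ^ 2))) x := by
    intro x
    have h := (hasDerivAt_id x).mul (((hasDerivAt_pow 2 x).const_mul (-s)).exp)
    refine h.congr_deriv ?_
    simp
    ring
  have h0 := integral_eq_zero_of_hasDerivAt_of_integrable hd
    ((integrable_exp_neg_mul_sq hs).sub ((sq_int hs).const_mul _)) (integrable_mul_exp_neg_mul_sq hs)
  rw [integral_sub (integrable_exp_neg_mul_sq hs) ((sq_int hs).const_mul _), integral_gaussian,
    integral_const_mul] at h0
  rw [eq_div_iff (by positivity)]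
  linarith

lemma odd_int (f : ℝ → ℝ) (hf : ∀ x, f (-x) = - f x) : ∫ x, f x = 0 := by
  have h := integral_neg_eq_self f volume
  simp only [hf, integral_neg] at h
  linarith

lemma shifted (c d r : ℝ) (hr : 0 < r) (hc : r ^ 2 = 1 + c ^ 2) :
    ∫ x : ℝ, x ^ 2 * (Real.exp (-x ^ 2) * Real.exp (-(c * x + d) ^ 2))
      = Real.sqrt Real.pi * Real.exp (-(d / r) ^ 2) * (1 / (2 * r ^ 3) + c ^ 2 * d ^ 2 / r ^ 5) := by
  have hs : 0 < r ^ 2 := by positivity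
  have hq : Real.sqrt (Real.pi / r ^ 2) = Real.sqrt Real.pi / r := by
    rw [Real.sqrt_div Real.pi_pos.le, Real.sqrt_sq hr.le]
  rw [← integral_sub_right_eq_self _ (c * d / r ^ 2)]
  have he : ∀ x : ℝ, (x - c * d / r ^ 2) ^ 2 * (Real.exp (-(x - c * d / r ^ 2) ^ 2) *
      Real.exp (-(c * (x - c * d / r ^ 2) + d) ^ 2)) =
      Real.exp (-(d / r) ^ 2) * (x ^ 2 * Real.exp (- r ^ 2 * x ^ 2)
        - (2 * (c * d / r ^ 2)) * (x * Real.exp (- r ^ 2 * x ^ 2))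
        + (c * d / r ^ 2) ^ 2 * Real.exp (- r ^ 2 * x ^ 2)) := by
    intro x
    have : Real.exp (-(x - c * d / r ^ 2) ^ 2) * Real.exp (-(c * (x - c * d / r ^ 2) + d) ^ 2)
        = Real.exp (-(d / r) ^ 2) * Real.exp (- r ^ 2 * x ^ 2) := by
      rw [← Real.exp_add, ← Real.exp_add]
      congr 1
      have hc2 : c ^ 2 = r ^ 2 - 1 := by linarith
      field_simp
      ring_nf
      have hc4 : c ^ 4 = (r ^ 2 - 1) ^ 2 := by rw [← hc2]; ring
      have hc3 : c ^ 3 = c * (r ^ 2 - 1) := by rw [← hc2]; ring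
      simp only [hc4, hc3, hc2]
      ring
    rw [this]
    ring
  simp_rw [he]
  have i0 := integrable_exp_neg_mul_sq hs
  have i1 := integrable_mul_exp_neg_mul_sq hs
  have i2 := sq_int hs
  have i3 : Integrable (fun x : ℝ => x ^ 2 * Real.exp (- r ^ 2 * x ^ 2)
        - (2 * (c * d / r ^ 2)) * (x * Real.exp (- r ^ 2 * x ^ 2))) := i2.sub (i1.const_mul _)
  rw [integral_const_mul, integral_add i3 (i0.const_mul _),
    integral_sub i2 (i1.const_mul _), integral_const_mul, integral_const_mul, sq_moment hs,
    integral_gaussian, odd_int (fun x => x * Real.exp (- r ^ 2 * x ^ 2)) (by intro x; simp), hq]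
  field_simp
  ring

lemma base_int (c d : ℝ) :
    Integrable fun x : ℝ => x ^ 2 * (Real.exp (-x ^ 2) * erf (c * x + d)) := by
  have h := sq_int one_pos
  have hm : AEStronglyMeasurable (fun x : ℝ => erf (c * x + d)) volume :=
    (erf_cont.comp (by fun_prop)).aestronglyMeasurable
  have := h.mul_bdd hm (Filter.Eventually.of_forall fun x => erf_bdd _)
  refine this.congr (Filter.Eventually.of_forall fun x => ?_)
  simp [mul_assoc]

lemma G_deriv (c d : ℝ) :
    HasDerivAt (fun d => ∫ x : ℝ, x ^ 2 * (Real.exp (-x ^ 2) * erf (c * x + d)))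
      (∫ x : ℝ, x ^ 2 * (Real.exp (-x ^ 2) *
        (2 / Real.sqrt Real.pi * Real.exp (-(c * x + d) ^ 2)))) d := by
  refine (hasDerivAt_integral_of_dominated_loc_of_deriv_le
    (bound := fun x => 2 / Real.sqrt Real.pi * (x ^ 2 * Real.exp (-1 * x ^ 2)))
    (F' := fun d x => x ^ 2 * (Real.exp (-x ^ 2) *
        (2 / Real.sqrt Real.pi * Real.exp (-(c * x + d) ^ 2))))
    Filter.univ_mem ?_ (base_int c d) ?_ ?_ ((sq_int one_pos).const_mul _) ?_).2
  · exact Filter.Eventually.of_forall fun d => (base_int c d).aestronglyMeasurable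
  · exact Continuous.aestronglyMeasurable (by fun_prop)
  · refine Filter.Eventually.of_forall fun x y _ => ?_
    rw [Real.norm_eq_abs, abs_of_nonneg (by positivity)]
    have : Real.exp (-(c * x + y) ^ 2) ≤ 1 := Real.exp_le_one_iff.2 (by nlinarith [sq_nonneg (c * x + y)])
    have h2 : 0 ≤ 2 / Real.sqrt Real.pi * (x ^ 2 * Real.exp (-x ^ 2)) := by positivity
    have := mul_le_mul_of_nonneg_left this h2
    rw [neg_one_mul]
    linarith
  · refine Filter.Eventually.of_forall fun x y _ => ?_
    have h := (erf_hasDerivAt (c * x + y)).comp_const_add (c * x) y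
    exact (h.const_mul _).const_mul _

lemma G_eq (c d r : ℝ) (hr : 0 < r) (hc : r ^ 2 = 1 + c ^ 2) :
    ∫ x : ℝ, x ^ 2 * (Real.exp (-x ^ 2) * erf (c * x + d))
      = Real.sqrt Real.pi / 2 * erf (d / r) - c ^ 2 / r ^ 3 * (d * Real.exp (-(d / r) ^ 2)) := by
  have hp : 0 < Real.sqrt Real.pi := Real.sqrt_pos.2 Real.pi_pos
  have hder : ∀ d, HasDerivAt (fun d => (∫ x : ℝ, x ^ 2 * (Real.exp (-x ^ 2) * erf (c * x + d)))
      - (Real.sqrt Real.pi / 2 * erf (d / r) - c ^ 2 / r ^ 3 * (d * Real.exp (-(d / r) ^ 2)))) 0 d := by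
    intro d
    have h1 := G_deriv c d
    have hdr : HasDerivAt (fun d : ℝ => d / r) (1 / r) d := (hasDerivAt_id d).div_const r
    have h2 : HasDerivAt (fun d => erf (d / r)) _ d := HasDerivAt.comp (h₂ := erf) d (erf_hasDerivAt (d / r)) hdr
    have h3 : HasDerivAt (fun d : ℝ => d * Real.exp (-(d / r) ^ 2)) _ d :=
      (hasDerivAt_id d).mul ((hdr.pow 2).neg.exp)
    refine (h1.sub ((h2.const_mul (Real.sqrt Real.pi / 2)).sub (h3.const_mul (c ^ 2 / r ^ 3)))).congr_deriv ?_
    have e : ∀ x : ℝ, x ^ 2 * (Real.exp (-x ^ 2) *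
        (2 / Real.sqrt Real.pi * Real.exp (-(c * x + d) ^ 2))) = 2 / Real.sqrt Real.pi *
        (x ^ 2 * (Real.exp (-x ^ 2) * Real.exp (-(c * x + d) ^ 2))) := by intro x; ring
    simp_rw [e]
    rw [integral_const_mul, shifted c d r hr hc]
    have hc2 : c ^ 2 = r ^ 2 - 1 := by linarith
    simp
    generalize Real.exp (-(d / r) ^ 2) = E
    rw [hc2]
    field_simp
    ring
  have hconst := is_const_of_deriv_eq_zero (fun d => (hder d).differentiableAt)
    (fun d => (hder d).deriv) d 0
  have hz : ∫ x : ℝ, x ^ 2 * (Real.exp (-x ^ 2) * erf (c * x + 0)) = 0 := by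
    apply odd_int
    intro x
    have : c * -x + 0 = - (c * x + 0) := by ring
    rw [this, erf_neg']
    ring
  have he0 : erf 0 = 0 := by simp [erf]
  simp only [hz, zero_div, he0] at hconst
  simp at hconst
  linarith

/-- **Second-moment × erf Gaussian integral.** For all `σ > 0`, `N_a, N_b > 0` and `a, b ∈ ℝ`,
`∫ (N_a(θ−a)²/(2σ²)) (√N_a/√(2πσ²)) e^{−N_a(θ−a)²/(2σ²)} (1/2)[1+erf(√N_b(θ−b)/√(2σ²))] dθ
  = (1/4)[1 + erf((a−b)/√(2σ²(1/N_a+1/N_b)))]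
    + ((b−a)σ²/(2N_a√(2π)(σ²/N_a+σ²/N_b)^{3/2})) e^{−(a−b)²/(2σ²(1/N_a+1/N_b))}`. -/
theorem second_moment_erf_gaussian_integral (σ Na Nb a b : ℝ)
    (hσ : 0 < σ) (hNa : 0 < Na) (hNb : 0 < Nb) :
    ∫ θ : ℝ,
        (Na * (θ - a) ^ 2 / (2 * σ ^ 2))
          * (Real.sqrt Na / Real.sqrt (2 * Real.pi * σ ^ 2))
          * Real.exp (-(Na * (θ - a) ^ 2) / (2 * σ ^ 2))
          * ((1 / 2) * (1 + erf (Real.sqrt Nb * (θ - b) / Real.sqrt (2 * σ ^ 2))))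
      = (1 / 4) * (1 + erf ((a - b) / Real.sqrt (2 * σ ^ 2 * (1 / Na + 1 / Nb))))
        + ((b - a) * σ ^ 2
              / (2 * Na * Real.sqrt (2 * Real.pi)
                  * (σ ^ 2 / Na + σ ^ 2 / Nb) ^ ((3 : ℝ) / 2)))
          * Real.exp (-(a - b) ^ 2 / (2 * σ ^ 2 * (1 / Na + 1 / Nb))) := by
  set t := Real.sqrt (2 * σ ^ 2) with ht
  have hp : 0 < Real.sqrt Real.pi := Real.sqrt_pos.2 Real.pi_pos
  have ht0 : 0 < t := Real.sqrt_pos.2 (by positivity)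
  have ht2 : t ^ 2 = 2 * σ ^ 2 := Real.sq_sqrt (by positivity)
  obtain ⟨A, hA⟩ : ∃ A, A = Real.sqrt Na := ⟨_, rfl⟩
  obtain ⟨B, hB⟩ : ∃ B, B = Real.sqrt Nb := ⟨_, rfl⟩
  have hA0 : 0 < A := hA ▸ Real.sqrt_pos.2 hNa
  have hB0 : 0 < B := hB ▸ Real.sqrt_pos.2 hNb
  have hA2 : Na = A ^ 2 := by rw [hA, Real.sq_sqrt hNa.le]
  have hB2 : Nb = B ^ 2 := by rw [hB, Real.sq_sqrt hNb.le]
  obtain ⟨R, hR⟩ : ∃ R, R = Real.sqrt (A ^ 2 + B ^ 2) := ⟨_, rfl⟩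
  have hR0 : 0 < R := hR ▸ Real.sqrt_pos.2 (by positivity)
  have hR2 : R ^ 2 = A ^ 2 + B ^ 2 := by rw [hR, Real.sq_sqrt (by positivity)]
  have hsq1 : Real.sqrt (2 * Real.pi * σ ^ 2) = t * Real.sqrt Real.pi := by
    rw [ht, ← Real.sqrt_mul (by positivity)]; congr 1; ring
  have hw : 2 * σ ^ 2 * (1 / Na + 1 / Nb) = (t * R / (A * B)) ^ 2 := by
    rw [div_pow, mul_pow, ht2, hR2, hA2, hB2]; field_simp; ring
  have hw2 : σ ^ 2 / Na + σ ^ 2 / Nb = (σ * R / (A * B)) ^ 2 := by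
    rw [div_pow, mul_pow, hR2, hA2, hB2]; field_simp; ring
  have hw3 : (σ ^ 2 / Na + σ ^ 2 / Nb) ^ ((3 : ℝ) / 2) = (σ * R / (A * B)) ^ 3 := by
    rw [hw2, ← Real.rpow_natCast, ← Real.rpow_mul (by positivity), ← Real.rpow_natCast]
    norm_num
  have hs2 : Real.sqrt (2 * Real.pi) = t / σ * Real.sqrt Real.pi := by
    rw [Real.sqrt_mul (by norm_num), ht, Real.sqrt_mul (by norm_num), Real.sqrt_sq hσ.le]
    field_simp
  rw [hw3, hw, hs2, hsq1, Real.sqrt_sq (by positivity), ← hA, ← hB, ← ht2]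
  have key := G_eq (B / A) (B * (a - b) / t) (R / A) (by positivity)
    (by rw [div_pow, div_pow, hR2]; field_simp)
  have hi : ∀ θ : ℝ, (Na * (θ - a) ^ 2 / t ^ 2) * (A / (t * Real.sqrt Real.pi))
      * Real.exp (-(Na * (θ - a) ^ 2) / t ^ 2) * ((1 / 2) * (1 + erf (B * (θ - b) / t)))
      = (A / (t * Real.sqrt Real.pi) / 2) * (fun x : ℝ => x ^ 2 * Real.exp (-1 * x ^ 2) +
        x ^ 2 * (Real.exp (-x ^ 2) * erf (B / A * x + B * (a - b) / t))) (A / t * (θ - a)) := by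
    intro θ
    have e1 : B / A * (A / t * (θ - a)) + B * (a - b) / t = B * (θ - b) / t := by field_simp; ring
    have e2 : -(Na * (θ - a) ^ 2) / t ^ 2 = -(A / t * (θ - a)) ^ 2 := by
      rw [hA2]; field_simp
    simp only [e1, e2, neg_one_mul]
    rw [hA2]
    ring
  simp_rw [hi]
  rw [integral_const_mul, integral_sub_right_eq_self (fun θ => (fun x : ℝ => x ^ 2 * Real.exp (-1 * x ^ 2) +
        x ^ 2 * (Real.exp (-x ^ 2) * erf (B / A * x + B * (a - b) / t))) (A / t * θ)) a,
    Measure.integral_comp_mul_left (fun x : ℝ => x ^ 2 * Real.exp (-1 * x ^ 2) +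
        x ^ 2 * (Real.exp (-x ^ 2) * erf (B / A * x + B * (a - b) / t))) (A / t), integral_add (sq_int one_pos) (base_int _ _), key,
    sq_moment one_pos, abs_of_pos (by positivity)]
  have e3 : B * (a - b) / t / (R / A) = (a - b) / (t * R / (A * B)) := by field_simp
  have e4 : -(a - b) ^ 2 / (t * R / (A * B)) ^ 2 = -((a - b) / (t * R / (A * B))) ^ 2 := by
    rw [div_pow]; ring
  rw [e3, e4, hA2]
  generalize Real.exp (-((a - b) / (t * R / (A * B))) ^ 2) = E
  generalize erf ((a - b) / (t * R / (A * B))) = F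
  simp only [smul_eq_mul, div_one]
  field_simp
  ring
end

section
/- (Closed form for the tail component of the entropy, Gaussian case.) For all σ > 0, N > 0 and b, c ∈ ℝ, letting g(θ) = (√N/√(2πσ²)) exp(−N(θ − b)²/(2σ²)) be the density of N(b, σ²/N), the truncated differential entropy satisfies −∫_{c}^{∞} g(θ) ln g(θ) dθ = (1/4) ln(2πσ²e/N) · erfc(√N(c − b)/√(2σ²)) + (√N(c − b)/(2√(2πσ²))) · exp(−N(c − b)²/(2σ²)). -/
open MeasureTheory

open MeasureTheory Filter Topology

lemma aux_erfc_deriv (u : ℝ) :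
    HasDerivAt erfc (-((2 / Real.sqrt Real.pi) * Real.exp (-u ^ 2))) u := by
  have hc : Continuous (fun u : ℝ => Real.exp (-u ^ 2)) := by fun_prop
  have h := (hc.integral_hasStrictDerivAt 0 u).hasDerivAt
  exact (h.const_mul (2 / Real.sqrt Real.pi)).const_sub 1

lemma aux_erfc_tendsto : Tendsto erfc atTop (𝓝 0) := by
  have hi : Integrable (fun u : ℝ => Real.exp (-u ^ 2)) := by
    simpa using integrable_exp_neg_mul_sq (b := 1) one_pos
  have h := intervalIntegral_tendsto_integral_Ioi 0 hi.integrableOn tendsto_id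
  have hv : ∫ u in Set.Ioi (0:ℝ), Real.exp (-u ^ 2) = Real.sqrt Real.pi / 2 := by
    simpa using integral_gaussian_Ioi 1
  rw [hv] at h
  have h2 := (h.const_mul (2 / Real.sqrt Real.pi)).const_sub 1
  have hp : Real.sqrt Real.pi ≠ 0 := (Real.sqrt_pos.2 Real.pi_pos).ne'
  have e : (1:ℝ) - 2 / Real.sqrt Real.pi * (Real.sqrt Real.pi / 2) = 0 := by
    field_simp; norm_num
  rw [e] at h2
  exact h2

lemma aux_tendsto : Tendsto (fun u : ℝ => u * Real.exp (-u ^ 2)) atTop (𝓝 0) := by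
  have h := (tendsto_rpow_abs_mul_exp_neg_mul_sq_cocompact (a := 1) one_pos 1).mono_left
    (atTop_le_cocompact (α := ℝ))
  refine h.congr' ?_
  filter_upwards [eventually_ge_atTop 0] with u hu
  simp [abs_of_nonneg hu]

lemma aux_int : Integrable (fun u : ℝ => u ^ 2 * Real.exp (-u ^ 2)) := by
  simpa using integrable_rpow_mul_exp_neg_mul_sq (b := 1) one_pos (s := 2) (by norm_num)

lemma aux_main (A k b c : ℝ) (hk : 0 < k) :
    ∫ x in Set.Ioi c, k / Real.sqrt Real.pi * Real.exp (-(k * (x - b)) ^ 2)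
        * (-(2 * A) + 1 / 2 - (k * (x - b)) ^ 2)
      = -(A * erfc (k * (c - b))
        + k * (c - b) / (2 * Real.sqrt Real.pi) * Real.exp (-(k * (c - b)) ^ 2)) := by
  have hp : Real.sqrt Real.pi ≠ 0 := (Real.sqrt_pos.2 Real.pi_pos).ne'
  have hH : ∀ u : ℝ, HasDerivAt
      (fun u => A * erfc u + u / (2 * Real.sqrt Real.pi) * Real.exp (-u ^ 2))
      (1 / Real.sqrt Real.pi * Real.exp (-u ^ 2) * (-(2 * A) + 1 / 2 - u ^ 2)) u := by
    intro u
    have h1 := (aux_erfc_deriv u).const_mul A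
    have h2 : HasDerivAt (fun u : ℝ => Real.exp (-u ^ 2))
        (Real.exp (-u ^ 2) * (-(2 * u))) u := by
      have := ((hasDerivAt_pow 2 u).fun_neg).exp
      simpa using this
    have h3 := ((hasDerivAt_id u).div_const (2 * Real.sqrt Real.pi)).fun_mul h2
    refine (h1.fun_add h3).congr_deriv ?_
    simp only [id]
    field_simp
    ring
  have hHt : Tendsto (fun u => A * erfc u + u / (2 * Real.sqrt Real.pi) * Real.exp (-u ^ 2))
      atTop (𝓝 0) := by
    have := (aux_erfc_tendsto.const_mul A).add
      (aux_tendsto.const_mul (1 / (2 * Real.sqrt Real.pi)))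
    simp only [mul_zero, add_zero] at this
    refine this.congr fun u => ?_
    ring
  have hi : Integrable (fun u : ℝ =>
      k / Real.sqrt Real.pi * Real.exp (-u ^ 2) * (-(2 * A) + 1 / 2 - u ^ 2)) := by
    have h0 : Integrable (fun u : ℝ => Real.exp (-u ^ 2)) := by
      simpa using integrable_exp_neg_mul_sq (b := 1) one_pos
    refine ((h0.const_mul (k / Real.sqrt Real.pi * (-(2 * A) + 1 / 2))).sub
      (aux_int.const_mul (k / Real.sqrt Real.pi))).congr (Eventually.of_forall fun u => ?_)
    simp only [Pi.sub_apply]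
    ring
  have hi2 := (hi.comp_mul_left' hk.ne').comp_sub_right b
  have hlim : Tendsto (fun x : ℝ => k * (x - b)) atTop atTop :=
    (tendsto_atTop_add_const_right atTop (-b) tendsto_id).const_mul_atTop hk
  have := integral_Ioi_of_hasDerivAt_of_tendsto' (a := c) (m := 0)
    (f := fun x => A * erfc (k * (x - b))
        + k * (x - b) / (2 * Real.sqrt Real.pi) * Real.exp (-(k * (x - b)) ^ 2))
    (f' := fun x => k / Real.sqrt Real.pi * Real.exp (-(k * (x - b)) ^ 2)
        * (-(2 * A) + 1 / 2 - (k * (x - b)) ^ 2))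
    (fun x _ => by
      have h1 : HasDerivAt (fun x : ℝ => k * (x - b)) k x := by
        simpa using ((hasDerivAt_id x).sub_const b).const_mul k
      refine ((hH (k * (x - b))).comp x h1).congr_deriv ?_
      ring)
    hi2.integrableOn (hHt.comp hlim)
  rw [this, zero_sub]

/-- **Closed form for the tail component of the entropy (Gaussian case).**
With `g` the density of `N(b, σ²/N)`, the truncated differential entropy satisfies
`−∫_c^∞ g(θ) ln g(θ) dθ = (1/4) ln(2πσ²e/N) erfc(√N(c−b)/√(2σ²))
  + (√N(c−b)/(2√(2πσ²))) e^{−N(c−b)²/(2σ²)}`. -/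
theorem entropy_tail_closed_form (σ N b c : ℝ) (hσ : 0 < σ) (hN : 0 < N)
    (g : ℝ → ℝ)
    (hg : g = fun θ => Real.sqrt N / Real.sqrt (2 * Real.pi * σ ^ 2)
      * Real.exp (-(N * (θ - b) ^ 2) / (2 * σ ^ 2))) :
    -∫ θ in Set.Ioi c, g θ * Real.log (g θ)
      = (1 / 4) * Real.log (2 * Real.pi * σ ^ 2 * Real.exp 1 / N)
          * erfc (Real.sqrt N * (c - b) / Real.sqrt (2 * σ ^ 2))
        + (Real.sqrt N * (c - b) / (2 * Real.sqrt (2 * Real.pi * σ ^ 2)))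
          * Real.exp (-(N * (c - b) ^ 2) / (2 * σ ^ 2)) := by
  have hp := Real.pi_pos
  have hsN : 0 < Real.sqrt N := Real.sqrt_pos.2 hN
  have hs2 : 0 < Real.sqrt (2 * σ ^ 2) := Real.sqrt_pos.2 (by positivity)
  have hsp : 0 < Real.sqrt Real.pi := Real.sqrt_pos.2 hp
  have hsplit : Real.sqrt (2 * Real.pi * σ ^ 2)
      = Real.sqrt (2 * σ ^ 2) * Real.sqrt Real.pi := by
    rw [← Real.sqrt_mul (by positivity)]; congr 1; ring
  obtain ⟨k, hkdef⟩ : ∃ k, k = Real.sqrt N / Real.sqrt (2 * σ ^ 2) := ⟨_, rfl⟩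
  have hk : 0 < k := by rw [hkdef]; positivity
  have hk2 : k ^ 2 = N / (2 * σ ^ 2) := by
    rw [hkdef, div_pow, Real.sq_sqrt hN.le, Real.sq_sqrt (by positivity)]
  have hexp : ∀ x : ℝ, -(N * (x - b) ^ 2) / (2 * σ ^ 2) = -(k * (x - b)) ^ 2 := by
    intro x; rw [mul_pow, hk2]; ring
  have hpre : Real.sqrt N / Real.sqrt (2 * Real.pi * σ ^ 2) = k / Real.sqrt Real.pi := by
    rw [hsplit, hkdef, div_div]
  have hlogk : Real.log (k / Real.sqrt Real.pi)
      = -(2 * ((1 / 4) * Real.log (2 * Real.pi * σ ^ 2 * Real.exp 1 / N))) + 1 / 2 := by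
    have e : 2 * Real.pi * σ ^ 2 * Real.exp 1 / N
        = ((k / Real.sqrt Real.pi) ^ 2)⁻¹ * Real.exp 1 := by
      rw [div_pow, hk2, Real.sq_sqrt hp.le]; field_simp
    rw [e, Real.log_mul (by positivity) (by positivity), Real.log_inv, Real.log_pow,
      Real.log_exp]
    push_cast
    ring
  have hu : Real.sqrt N * (c - b) / Real.sqrt (2 * σ ^ 2) = k * (c - b) := by
    rw [hkdef]; ring
  have hco : Real.sqrt N * (c - b) / (2 * Real.sqrt (2 * Real.pi * σ ^ 2))
      = k * (c - b) / (2 * Real.sqrt Real.pi) := by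
    rw [hsplit, hkdef]; field_simp
  have hint : ∀ x, g x * Real.log (g x) = k / Real.sqrt Real.pi * Real.exp (-(k * (x - b)) ^ 2)
        * (-(2 * ((1 / 4) * Real.log (2 * Real.pi * σ ^ 2 * Real.exp 1 / N))) + 1 / 2
          - (k * (x - b)) ^ 2) := by
    intro x
    have hgx : g x = k / Real.sqrt Real.pi * Real.exp (-(k * (x - b)) ^ 2) := by
      rw [hg]; simp only [hpre, hexp]
    rw [hgx, Real.log_mul (by positivity) (by positivity), Real.log_exp, hlogk]
    ring
  simp only [hint]
  rw [aux_main _ k b c hk, neg_neg, hu, hco, hexp]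
end

section
/- (Gaussian average of the tail entropy term.) For all σ > 0, N > 0, real M > 0 and c ∈ ℝ, ∫_{−∞}^{∞} (1/√(2πσ²)) e^{−μ²/(2σ²)} · ( √N (c + μ/M) / (2√(2πσ²)) ) · exp(−N(c + μ/M)²/(2σ²)) dμ = exp( −N c² / (2σ²(1 + N/M²)) ) · sqrt(N/(8πσ²)) · c / (1 + N/M²)^{3/2}. (Taking N = N_min, M = N_max + 1, c = θ_eq − μ̂_min recovers the expected tail-entropy after pulling the empirically better arm; taking N = M = N_min + 1 recovers it after pulling the empirically worse arm.) -/
open MeasureTheory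

/-- **Gaussian average of the tail entropy term.** For all `σ > 0`, `N > 0`, `M > 0`, `c ∈ ℝ`,
`∫ (2πσ²)^{-1/2} e^{−μ²/(2σ²)} (√N(c + μ/M)/(2√(2πσ²))) e^{−N(c + μ/M)²/(2σ²)} dμ
  = e^{−Nc²/(2σ²(1 + N/M²))} √(N/(8πσ²)) c/(1 + N/M²)^{3/2}`. -/
theorem gaussian_average_tail_entropy (σ N M c : ℝ)
    (hσ : 0 < σ) (hN : 0 < N) (hM : 0 < M) :
    ∫ μ : ℝ,
        (Real.exp (-μ ^ 2 / (2 * σ ^ 2)) / Real.sqrt (2 * Real.pi * σ ^ 2))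
          * (Real.sqrt N * (c + μ / M) / (2 * Real.sqrt (2 * Real.pi * σ ^ 2)))
          * Real.exp (-(N * (c + μ / M) ^ 2) / (2 * σ ^ 2))
      = Real.exp (-(N * c ^ 2) / (2 * σ ^ 2 * (1 + N / M ^ 2)))
          * Real.sqrt (N / (8 * Real.pi * σ ^ 2))
          * (c / (1 + N / M ^ 2) ^ ((3 : ℝ) / 2)) := by
  have hA : 0 < 1 + N / M ^ 2 := by positivity
  obtain ⟨A, hAd⟩ : ∃ A, A = 1 + N / M ^ 2 := ⟨_, rfl⟩
  rw [← hAd] at hA ⊢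
  have hNA : N = (A - 1) * M ^ 2 := by rw [hAd]; field_simp; ring
  have hb : 0 < A / (2 * σ ^ 2) := by positivity
  obtain ⟨b, hbd⟩ : ∃ b, b = A / (2 * σ ^ 2) := ⟨_, rfl⟩
  rw [← hbd] at hb
  obtain ⟨S, hS⟩ : ∃ S, S = Real.sqrt (2 * Real.pi * σ ^ 2) := ⟨_, rfl⟩
  have hSp : 0 < S := by rw [hS]; positivity
  have hodd : ∫ x : ℝ, x * Real.exp (-b * x ^ 2) = 0 := by
    have h := integral_neg_eq_self (fun x : ℝ => x * Real.exp (-b * x ^ 2)) volume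
    simp only [neg_sq, neg_mul, integral_neg] at h ⊢
    linarith
  rw [← integral_sub_right_eq_self _ (N * c / (M * A))]
  rw [← hS]
  have key : ∀ x : ℝ,
      (Real.exp (-(x - N * c / (M * A)) ^ 2 / (2 * σ ^ 2)) / S)
          * (Real.sqrt N * (c + (x - N * c / (M * A)) / M) / (2 * S))
          * Real.exp (-(N * (c + (x - N * c / (M * A)) / M) ^ 2) / (2 * σ ^ 2))
      = (Real.exp (-(N * c ^ 2) / (2 * σ ^ 2 * A)) * Real.sqrt N / (2 * S ^ 2)) *
        (c / A * Real.exp (-b * x ^ 2) + 1 / M * (x * Real.exp (-b * x ^ 2))) := by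
    intro x
    have h1 : c + (x - N * c / (M * A)) / M = c / A + x / M := by
      rw [hNA]; field_simp; ring
    have h2 : Real.exp (-(x - N * c / (M * A)) ^ 2 / (2 * σ ^ 2)) *
        Real.exp (-(N * (c / A + x / M) ^ 2) / (2 * σ ^ 2)) =
        Real.exp (-(N * c ^ 2) / (2 * σ ^ 2 * A)) * Real.exp (-b * x ^ 2) := by
      rw [← Real.exp_add, ← Real.exp_add, hbd, hNA]
      congr 1
      field_simp
      ring
    rw [h1]
    calc _ = (Real.exp (-(x - N * c / (M * A)) ^ 2 / (2 * σ ^ 2)) *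
        Real.exp (-(N * (c / A + x / M) ^ 2) / (2 * σ ^ 2))) *
          (Real.sqrt N * (c / A + x / M) / (2 * S ^ 2)) := by field_simp
      _ = _ := by rw [h2]; field_simp
  simp_rw [key]
  rw [integral_const_mul, integral_add ((integrable_exp_neg_mul_sq hb).const_mul _)
    ((integrable_mul_exp_neg_mul_sq hb).const_mul _), integral_const_mul, integral_const_mul,
    hodd, integral_gaussian]
  have e1 : Real.sqrt (Real.pi / b) = S / Real.sqrt A := by
    rw [hS, ← Real.sqrt_div (by positivity), hbd]
    congr 1
    field_simp
  have e2 : Real.sqrt (N / (8 * Real.pi * σ ^ 2)) = Real.sqrt N / (2 * S) := by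
    rw [Real.sqrt_div hN.le, hS]
    congr 1
    rw [show 8 * Real.pi * σ ^ 2 = 2 ^ 2 * (2 * Real.pi * σ ^ 2) by ring,
      Real.sqrt_mul (by positivity), Real.sqrt_sq (by norm_num)]
  have e3 : A ^ ((3 : ℝ) / 2) = A * Real.sqrt A := by
    rw [show (3 : ℝ) / 2 = 1 + 1 / 2 by norm_num, Real.rpow_add hA, Real.rpow_one,
      Real.sqrt_eq_rpow]
  rw [e1, e2, e3]
  have : 0 < Real.sqrt A := Real.sqrt_pos.2 hA
  field_simp
  ring
end
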